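/- Let p ≥ 2 be an integer and K ≥ 0 a constant such that every smooth function f : ℝ → ℝ satisfies ‖(Π_p f)'‖_{L²(−1,1)} ≤ K · ‖f'‖_{L²(−1,1)}. Then K² ≥ p(p−1)/(2(2p+1)); in particular K² ≥ p/10, so the H¹-seminorm stability constant of the L² projection Π_p on the interval (−1,1) grows at least like √p. (Witnessed by f = L̂_p, for which ‖(Π_p L̂_p)'‖²_{L²(−1,1)} = p(p−1)/(2p+1)² and ‖L̂_p'‖²_{L²(−1,1)} = 2/(2p+1).) -/

import Mathlib

open MeasureTheory

noncomputable section

/-- The `k`-th Legendre polynomial via Rodrigues' formula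
`L_k(x) = (1/(2^k k!)) dᵏ/dxᵏ (x² − 1)ᵏ`. -/
def legendre (k : ℕ) : Polynomial ℝ :=
  Polynomial.C (1 / (2 ^ k * (Nat.factorial k : ℝ))) *
    (Polynomial.derivative (R := ℝ))^[k] ((Polynomial.X ^ 2 - 1) ^ k)

/-- `L̂_k(x) = ∫_{−1}^x L_k(t) dt`, the antiderivative of the `k`-th Legendre polynomial. -/
def Lhat (k : ℕ) (x : ℝ) : ℝ := ∫ t in (-1 : ℝ)..x, (legendre k).eval t

/-- `g` is (the function of) a real polynomial of degree at most `m`. -/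
def IsPoly1D (m : ℕ) (g : ℝ → ℝ) : Prop :=
  ∃ P : Polynomial ℝ, P.natDegree ≤ m ∧ ∀ x, g x = P.eval x

/-- `g = Π_m f` is the `L²(−1,1)`-orthogonal projection of `f` onto `P_m(−1,1)`:
`g` is a polynomial of degree at most `m` and `f − g ⊥ P_m(−1,1)` in `L²(−1,1)`. -/
def IsProj1D (m : ℕ) (f g : ℝ → ℝ) : Prop :=
  IsPoly1D m g ∧ ∀ q : ℝ → ℝ, IsPoly1D m q → (∫ x in (-1 : ℝ)..1, (f x - g x) * q x) = 0

open Polynomial in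
theorem derivative_legendre_add_two (n : ℕ) :
    derivative (legendre (n + 2)) =
      C (2 * (n : ℝ) + 3) * legendre (n + 1) + derivative (legendre n) := by
  have hD : derivative (derivative ((X ^ 2 - 1 : ℝ[X]) ^ (n + 2))) =
      C (2 * ((n : ℝ) + 2)) * (C (2 * (n : ℝ) + 3) * (X ^ 2 - 1) ^ (n + 1) +
        C (2 * ((n : ℝ) + 1)) * (X ^ 2 - 1) ^ n) := by
    simp only [derivative_pow_succ, derivative_mul, derivative_sub, derivative_add,
      derivative_one, derivative_X, derivative_natCast, map_mul, map_natCast, map_ofNat,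
      map_one, map_zero, C_add, Nat.cast_add, Nat.cast_one]
    ring
  have hf : (Nat.factorial n : ℝ) ≠ 0 := by positivity
  have h2 : (n : ℝ) + 1 + 1 ≠ 0 := by positivity
  have h1 : (n : ℝ) + 1 ≠ 0 := by positivity
  unfold legendre
  rw [derivative_C_mul, ← Function.iterate_succ_apply' derivative, Function.iterate_succ_apply,
    Function.iterate_succ_apply, hD, iterate_derivative_C_mul, iterate_map_add,
    iterate_derivative_C_mul, iterate_derivative_C_mul, derivative_C_mul,
    ← Function.iterate_succ_apply' derivative, mul_add, mul_add, ← mul_assoc, ← mul_assoc,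
    ← mul_assoc, ← mul_assoc, ← mul_assoc, ← C_mul, ← C_mul, ← C_mul, ← C_mul]
  congr 3
  all_goals
    simp only [Nat.factorial_succ]
    push_cast
    field_simp
    try ring

open Polynomial in
theorem eval_iterate_derivative_sq_sub_one_pow {m n : ℕ} (h : m < n) {s : ℝ} (hs : s ^ 2 = 1) :
    (derivative^[m] ((X ^ 2 - 1 : ℝ[X]) ^ n)).eval s = 0 := by
  obtain ⟨q, hq⟩ := pow_sub_dvd_iterate_derivative_pow (X ^ 2 - 1 : ℝ[X]) n m
  rw [hq]
  simp [hs, (Nat.sub_pos_of_lt h).ne']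

open Polynomial in
theorem eval_legendre (n : ℕ) {s : ℝ} (hs : s ^ 2 = 1) : (legendre n).eval s = s ^ n := by
  induction n with
  | zero => simp [legendre]
  | succ n ih =>
    have hD : derivative ((X ^ 2 - 1 : ℝ[X]) ^ (n + 1)) =
        C (2 * ((n : ℝ) + 1)) * ((X ^ 2 - 1) ^ n * X) := by
      simp only [derivative_pow_succ, derivative_sub, derivative_X, derivative_one, C_add,
        map_mul, map_natCast, map_ofNat, map_one]
      ring
    have hz : (n : ℝ) * (derivative^[n - 1] ((X ^ 2 - 1 : ℝ[X]) ^ n)).eval s = 0 := by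
      rcases n with _ | n
      · simp
      · rw [eval_iterate_derivative_sq_sub_one_pow (by omega) hs, mul_zero]
    have hf : (Nat.factorial n : ℝ) ≠ 0 := by positivity
    have h1 : (n : ℝ) + 1 ≠ 0 := by positivity
    unfold legendre at ih ⊢
    rw [Function.iterate_succ_apply, hD, iterate_derivative_C_mul, iterate_derivative_mul_X]
    simp only [eval_mul, eval_C, eval_add, eval_X, nsmul_eq_mul, eval_natCast, hz] at ih ⊢
    rw [pow_succ s, ← ih, Nat.factorial_succ]
    push_cast
    field_simp
    ring

open Polynomial in
theorem eval_derivative_legendre (n : ℕ) {s : ℝ} (hs : s ^ 2 = 1) :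
    (derivative (legendre n)).eval s = s ^ (n + 1) * (n * (n + 1) / 2) := by
  induction n using Nat.twoStepInduction with
  | zero => simp [legendre]
  | one =>
    simp [legendre, hs]
    norm_num
  | more n ih _ =>
    rw [derivative_legendre_add_two, eval_add, ih, eval_mul, eval_C, eval_legendre _ hs,
      show n + 2 + 1 = n + 1 + 2 by ring, pow_add s (n + 1) 2, hs]
    push_cast
    ring

open Polynomial in
theorem natDegree_legendre_le (n : ℕ) : (legendre n).natDegree ≤ n := by
  unfold legendre
  refine (natDegree_C_mul_le _ _).trans ((natDegree_iterate_derivative _ _).trans ?_)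
  have h2 : (X ^ 2 - 1 : ℝ[X]).natDegree ≤ 2 := by compute_degree
  have := natDegree_pow_le_of_le n h2
  omega

open Polynomial in
/-- Integration of a real polynomial over `[-1, 1]`, as a linear functional. -/
def polyIntegral : ℝ[X] →ₗ[ℝ] ℝ where
  toFun P := ∫ x in (-1 : ℝ)..1, P.eval x
  map_add' P Q := by
    simp only [eval_add]
    exact intervalIntegral.integral_add (P.continuous.intervalIntegrable _ _)
      (Q.continuous.intervalIntegrable _ _)
  map_smul' c P := by simp

open Polynomial in
theorem polyIntegral_C_mul (c : ℝ) (P : ℝ[X]) : polyIntegral (C c * P) = c * polyIntegral P := by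
  rw [← smul_eq_C_mul, map_smul, smul_eq_mul]

open Polynomial in
theorem polyIntegral_mul_derivative (P Q : ℝ[X]) :
    polyIntegral (P * derivative Q) =
      P.eval 1 * Q.eval 1 - P.eval (-1) * Q.eval (-1) - polyIntegral (derivative P * Q) := by
  have := intervalIntegral.integral_mul_deriv_eq_deriv_mul (a := (-1 : ℝ)) (b := 1)
    (fun x _ => P.hasDerivAt x) (fun x _ => Q.hasDerivAt x)
    ((derivative P).continuous.intervalIntegrable _ _)
    ((derivative Q).continuous.intervalIntegrable _ _)
  simpa [polyIntegral] using this

open Polynomial in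
theorem polyIntegral_mul_iterate_derivative (n m : ℕ) (hm : m ≤ n) (q : ℝ[X]) :
    polyIntegral (q * derivative^[m] ((X ^ 2 - 1) ^ n)) =
      (-1) ^ m * polyIntegral (derivative^[m] q * (X ^ 2 - 1) ^ n) := by
  induction m generalizing q with
  | zero => simp
  | succ m ih =>
    rw [Function.iterate_succ_apply', polyIntegral_mul_derivative,
      eval_iterate_derivative_sq_sub_one_pow hm (one_pow 2),
      eval_iterate_derivative_sq_sub_one_pow hm (by norm_num), ih (by omega),
      Function.iterate_succ_apply]
    ring

open Polynomial in
theorem polyIntegral_mul_legendre {n : ℕ} {q : ℝ[X]} (hq : q.natDegree < n) :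
    polyIntegral (q * legendre n) = 0 := by
  unfold legendre
  rw [mul_left_comm, polyIntegral_C_mul, polyIntegral_mul_iterate_derivative n n le_rfl,
    iterate_derivative_eq_zero hq]
  simp

open Polynomial in
theorem polyIntegral_derivative_legendre_sq (n : ℕ) :
    polyIntegral (derivative (legendre n) * derivative (legendre n)) = n * (n + 1) := by
  have hz : polyIntegral (derivative (derivative (legendre n)) * legendre n) = 0 := by
    rcases n with _ | n
    · simp [legendre]
    · apply polyIntegral_mul_legendre
      have h0 := natDegree_legendre_le (n + 1)
      have h1 := natDegree_derivative_le (legendre (n + 1))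
      have h2 := natDegree_derivative_le (derivative (legendre (n + 1)))
      omega
  have hs : ((-1 : ℝ)) ^ 2 = 1 := by norm_num
  rw [polyIntegral_mul_derivative, hz, eval_derivative_legendre _ (one_pow 2),
    eval_derivative_legendre _ hs, eval_legendre _ (one_pow 2), eval_legendre _ hs]
  have : ((-1 : ℝ)) ^ n * (-1) ^ n = 1 := by rw [← mul_pow]; simp
  simp only [one_pow, pow_succ]
  linear_combination (n * (n + 1) / 2 : ℝ) * this

open Polynomial in
theorem polyIntegral_legendre_sq (n : ℕ) :
    (2 * (n : ℝ) + 3) * polyIntegral (legendre (n + 1) * legendre (n + 1)) = 2 := by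
  have hd0 := natDegree_legendre_le n
  have hd1 := natDegree_legendre_le (n + 1)
  have hd0' := natDegree_derivative_le (legendre n)
  have hd1' := natDegree_derivative_le (legendre (n + 1))
  have hs : ((-1 : ℝ)) ^ 2 = 1 := by norm_num
  have h0 : polyIntegral (derivative (legendre n) * legendre (n + 1)) = 0 :=
    polyIntegral_mul_legendre (by omega)
  have h1 : polyIntegral (derivative (legendre (n + 1)) * legendre (n + 2)) = 0 :=
    polyIntegral_mul_legendre (by omega)
  have h2 := polyIntegral_mul_derivative (legendre (n + 1)) (legendre (n + 2))
  rw [h1, derivative_legendre_add_two, mul_add, map_add, mul_left_comm, polyIntegral_C_mul,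
    mul_comm (legendre (n + 1)) (derivative _), h0, eval_legendre _ (one_pow 2),
    eval_legendre _ hs, eval_legendre _ (one_pow 2), eval_legendre _ hs] at h2
  have : ((-1 : ℝ)) ^ n * (-1) ^ n = 1 := by rw [← mul_pow]; simp
  simp only [one_pow, pow_succ] at h2
  linear_combination h2 + this

open Polynomial in
/-- `-L_n` is the projection onto `P_{n+1}` of `L_{n+2} - L_n = (2n+3) L̂_{n+1}`. -/
theorem isProj1D_legendre_sub_legendre (n : ℕ) :
    IsProj1D (n + 1) (fun x => (legendre (n + 2) - legendre n).eval x)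
      (fun x => (-legendre n).eval x) := by
  refine ⟨⟨_, ?_, fun _ => rfl⟩, ?_⟩
  · rw [natDegree_neg]
    exact (natDegree_legendre_le n).trans n.le_succ
  · rintro q ⟨Q, hQ, hq⟩
    have := polyIntegral_mul_legendre (n := n + 2) (q := Q) (by omega)
    simpa [polyIntegral, hq, mul_comm] using this

/-- lower growth of the `H¹`-seminorm stability constant in 1D.
Let `p ≥ 2` and `K ≥ 0` be such that every smooth `f : ℝ → ℝ` satisfies
`‖(Π_p f)'‖_{L²(−1,1)} ≤ K ‖f'‖_{L²(−1,1)}`. Then `K² ≥ p(p−1)/(2(2p+1))`; in particular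
`K² ≥ p/10`. -/
theorem projection_H1_stability_lower_bound_1d (p : ℕ) (hp : 2 ≤ p) (K : ℝ) (hK : 0 ≤ K)
    (hstab : ∀ f : ℝ → ℝ, ContDiff ℝ (⊤ : ℕ∞) f →
      ∀ g : ℝ → ℝ, IsProj1D p f g →
        Real.sqrt (∫ x in (-1 : ℝ)..1, (deriv g x) ^ 2) ≤
          K * Real.sqrt (∫ x in (-1 : ℝ)..1, (deriv f x) ^ 2)) :
    (p : ℝ) * ((p : ℝ) - 1) / (2 * (2 * (p : ℝ) + 1)) ≤ K ^ 2 ∧ (p : ℝ) / 10 ≤ K ^ 2 := by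
  obtain ⟨n, rfl⟩ : ∃ n, p = n + 1 := ⟨p - 1, by omega⟩
  have hsmooth : ContDiff ℝ (⊤ : ℕ∞) fun x => (legendre (n + 2) - legendre n).eval x := by
    simpa only [Polynomial.coe_aeval_eq_eval] using
      (legendre (n + 2) - legendre n).contDiff_aeval (𝕜 := ℝ) (⊤ : ℕ∞)
  have h := hstab _ hsmooth _ (isProj1D_legendre_sub_legendre n)
  have hf : ∫ x in (-1 : ℝ)..1,
      (deriv (fun x => (legendre (n + 2) - legendre n).eval x) x) ^ 2 = 2 * (2 * (n : ℝ) + 3) := by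
    have h2 := polyIntegral_legendre_sq n
    simp only [Polynomial.deriv, Polynomial.derivative_sub, derivative_legendre_add_two,
      add_sub_cancel_right, Polynomial.eval_mul, Polynomial.eval_C, mul_pow,
      intervalIntegral.integral_const_mul]
    simp only [polyIntegral, LinearMap.coe_mk, AddHom.coe_mk, Polynomial.eval_pow, ← sq] at h2
    linear_combination (2 * (n : ℝ) + 3) * h2
  have hg : ∫ x in (-1 : ℝ)..1, (deriv (fun x => (-legendre n).eval x) x) ^ 2 =
      (n : ℝ) * (n + 1) := by
    have h2 := polyIntegral_derivative_legendre_sq n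
    simp_rw [Polynomial.deriv, Polynomial.derivative_neg, Polynomial.eval_neg, neg_sq]
    simpa only [polyIntegral, LinearMap.coe_mk, AddHom.coe_mk, Polynomial.eval_pow, ← sq] using h2
  rw [hf, hg] at h
  have hsq := pow_le_pow_left₀ (Real.sqrt_nonneg _) h 2
  rw [mul_pow, Real.sq_sqrt (by positivity), Real.sq_sqrt (by positivity)] at hsq
  have hn : (1 : ℝ) ≤ n := by exact_mod_cast (by omega : 1 ≤ n)
  have key : ((n + 1 : ℕ) : ℝ) * (((n + 1 : ℕ) : ℝ) - 1) / (2 * (2 * ((n + 1 : ℕ) : ℝ) + 1)) ≤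
      K ^ 2 := by
    rw [div_le_iff₀ (by positivity)]
    push_cast
    linarith
  refine ⟨key, le_trans ?_ key⟩
  rw [div_le_div_iff₀ (by norm_num) (by positivity)]
  push_cast
  nlinarith

end
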